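/- Let w be a word of length n and let 1 ≤ j < j' ≤ n−1 be indices such that π'_w[j'] − π'_w[j] > j' − j (as integers). Then π_w[j] ≠ π'_w[j], i.e., π_w[j] > π'_w[j]; equivalently, j cannot be the last element of a slope (so π_w[j+1] = π_w[j]+1). -/

import Mathlib

/- A word over alphabet `α` is modelled as `w : ℕ → α`, indexed `w 1, …, w n`. -/

/-- `IsBorder w i b`: `b` is the length of a border (possibly non-proper) of the
prefix `w[1..i]`, i.e. `b ≤ i` and `w[1..b] = w[i-b+1..i]`. -/
def IsBorder {α : Type*} (w : ℕ → α) (i b : ℕ) : Prop :=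
  b ≤ i ∧ ∀ t, 1 ≤ t → t ≤ b → w t = w (i - b + t)

/-- The failure function (border array) `π_w[i]`: the length of the longest proper
border of `w[1..i]`. -/
noncomputable def piF {α : Type*} (w : ℕ → α) (i : ℕ) : ℕ :=
  sSup {b | b < i ∧ IsBorder w i b}

/- The strong failure function `π'_w[i]` of a word of length `n`, valued in `ℤ`:
`π'_w[n] = π_w[n]`, and for `i < n` the length of the longest proper border `b` of
`w[1..i]` with `w[b+1] ≠ w[i+1]`, or `-1` if no such border exists. -/
open Classical in
noncomputable def piF' {α : Type*} (w : ℕ → α) (n i : ℕ) : ℤ :=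
  if i = n then (piF w i : ℤ)
  else if ({b | b < i ∧ IsBorder w i b ∧ w (b + 1) ≠ w (i + 1)} : Set ℕ).Nonempty
    then ((sSup {b | b < i ∧ IsBorder w i b ∧ w (b + 1) ≠ w (i + 1)} : ℕ) : ℤ)
    else -1

section FailureFunction

variable {α : Type*} {w : ℕ → α} {n i b d : ℕ}

theorem IsBorder.zero (w : ℕ → α) (i : ℕ) : IsBorder w i 0 :=
  ⟨Nat.zero_le i, fun t ht ht' => by omega⟩

/-- Dropping the last `d` letters of a word shortens each of its borders by `d`. -/
theorem IsBorder.of_add (h : IsBorder w (i + d) (b + d)) : IsBorder w i b := by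
  obtain ⟨hle, heq⟩ := h
  refine ⟨by omega, fun t ht htb => ?_⟩
  have := heq t ht (by omega)
  rwa [show i + d - (b + d) + t = i - b + t by omega] at this

theorem IsBorder.succ (h : IsBorder w i b) (hw : w (b + 1) = w (i + 1)) :
    IsBorder w (i + 1) (b + 1) := by
  obtain ⟨hle, heq⟩ := h
  refine ⟨by omega, fun t ht htb => ?_⟩
  rcases Nat.lt_or_ge b t with hbt | hbt
  · obtain rfl : t = b + 1 := by omega
    rwa [show i + 1 - (b + 1) + (b + 1) = i + 1 by omega]
  · rw [show i + 1 - (b + 1) + t = i - b + t by omega]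
    exact heq t ht hbt

theorem bddAbove_of_forall_lt {p : ℕ → Prop} : BddAbove {b | b < i ∧ p b} :=
  ⟨i, fun _ hb => hb.1.le⟩

theorem le_piF (hb : b < i) (h : IsBorder w i b) : b ≤ piF w i :=
  le_csSup bddAbove_of_forall_lt ⟨hb, h⟩

theorem piF_spec (w : ℕ → α) (hi : 0 < i) : piF w i < i ∧ IsBorder w i (piF w i) :=
  Nat.sSup_mem (s := {b | b < i ∧ IsBorder w i b}) ⟨0, hi, IsBorder.zero w i⟩
    bddAbove_of_forall_lt

theorem piF_succ (hi : 0 < i) (hw : w (piF w i + 1) = w (i + 1)) :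
    piF w (i + 1) = piF w i + 1 := by
  obtain ⟨hlt, hborder⟩ := piF_spec w hi
  refine le_antisymm ?_ (le_piF (by omega) (hborder.succ hw))
  obtain ⟨hlt', hborder'⟩ := piF_spec w i.succ_pos
  rcases h : piF w (i + 1) with _ | c
  · omega
  · simp only [Nat.succ_eq_add_one, h] at hlt' hborder'
    have := le_piF (by omega) hborder'.of_add
    omega

theorem neg_one_le_piF' (w : ℕ → α) (n i : ℕ) : -1 ≤ piF' w n i := by
  unfold piF'
  split_ifs <;> omega

theorem le_piF' (hin : i ≠ n) (hb : b < i) (h : IsBorder w i b) (hw : w (b + 1) ≠ w (i + 1)) :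
    (b : ℤ) ≤ piF' w n i := by
  unfold piF'
  rw [if_neg hin, if_pos ⟨b, hb, h, hw⟩]
  exact Int.ofNat_le.mpr (le_csSup bddAbove_of_forall_lt ⟨hb, h, hw⟩)

theorem isBorder_of_piF'_eq (hin : i ≠ n) (h : piF' w n i = b) : b < i ∧ IsBorder w i b := by
  unfold piF' at h
  rw [if_neg hin] at h
  split_ifs at h with hne
  have hmem := Nat.sSup_mem hne bddAbove_of_forall_lt
  rw [Nat.cast_injective h] at hmem
  exact ⟨hmem.1, hmem.2.1⟩

end FailureFunction

/-- If `1 ≤ j < j' ≤ n-1` and `π'_w[j'] - π'_w[j] > j' - j` (as integers), then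
`π_w[j] ≠ π'_w[j]`, i.e. `π_w[j] > π'_w[j]`; equivalently `j` is not the last
element of a slope, so `π_w[j+1] = π_w[j] + 1`. -/
theorem dominated_not_end_of_slope {α : Type*} (w : ℕ → α) (n j j' : ℕ)
    (h1 : 1 ≤ j) (h2 : j < j') (h3 : j' ≤ n - 1)
    (hdom : (j' : ℤ) - (j : ℤ) < piF' w n j' - piF' w n j) :
    (piF w j : ℤ) ≠ piF' w n j ∧ piF' w n j < (piF w j : ℤ) ∧
      piF w (j + 1) = piF w j + 1 := by
  have hj : j ≠ n := by omega
  have hj' : j' ≠ n := by omega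
  have hneg := neg_one_le_piF' w n j
  obtain ⟨d, rfl⟩ := Nat.exists_eq_add_of_lt h2
  obtain ⟨c, hc⟩ : ∃ c : ℕ, piF' w n (j + d + 1) = ((c + (d + 1) : ℕ) : ℤ) :=
    ⟨(piF' w n (j + d + 1) - (d + 1)).toNat, by omega⟩
  obtain ⟨hlt, hborder⟩ := isBorder_of_piF'_eq hj' hc
  have hle : c ≤ piF w j := le_piF (by omega) (IsBorder.of_add (d := d + 1) hborder)
  have hgt : piF' w n j < (piF w j : ℤ) := by omega
  refine ⟨hgt.ne', hgt, piF_succ h1 ?_⟩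
  by_contra hw
  obtain ⟨hlt', hborder'⟩ := piF_spec w h1
  exact absurd (le_piF' hj hlt' hborder' hw) (not_le.mpr hgt)
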